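/- Let k ≥ 2 and let F be a k-graph on f vertices with a vanishing ordering τ = (v_1, …, v_f). Define a (k−1)-uniform directed hypergraph D on V(F) by: for each edge e = {v_{i(1)} < ⋯ < v_{i(k)}} of F (ordered by τ), include the directed edges (v_{i(ℓ)}, v_{i(ℓ+1)}, …, v_{i(ℓ+k−2)}) for all ℓ ∈ [k] (indices mod k), coloring the ℓ-th one with color ℓ−1. Then D is simple, and the transitive digraph of the sub-digraph D_{0,1} (edges colored 0 or 1) has every arc directed from a vertex of smaller τ-index to a vertex of larger τ-index; hence T(D_{0,1}) is acyclic. -/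

import Mathlib

open scoped Classical BigOperators

noncomputable section

/-- The rank (number of elements of `e` smaller under `ord`) of `x` in the finset `e`. -/
def rankIn {V : Type*} [DecidableEq V] (ord : V → ℕ) (e : Finset V) (x : V) : ℕ :=
  (e.filter (fun y => ord y < ord x)).card

/-- `F` is vanishing w.r.t. the vertex ordering induced by `ord`: the shadow `∂F` can be
partitioned into `k` classes `𝒞_1, …, 𝒞_k` (encoded by `C : Finset V → ℕ` with values
`< k`, class `ℓ` corresponding to value `ℓ − 1`) such that for every edge `e` and every
`x ∈ e`, the `(k−1)`-set `e ∖ {x}` lies in the class indexed by the rank of `x` in `e`. -/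
def IsVanishing {V : Type*} [DecidableEq V] (k : ℕ) (F : Finset (Finset V))
    (ord : V → ℕ) : Prop :=
  ∃ C : Finset V → ℕ, (∀ S, C S < k) ∧ ∀ e ∈ F, ∀ x ∈ e, C (e.erase x) = rankIn ord e x

/-- `F` has a vanishing ordering of its vertex set. -/
def HasVanishingOrdering {V : Type*} [DecidableEq V] (k : ℕ)
    (F : Finset (Finset V)) : Prop :=
  ∃ ord : V → ℕ, Function.Injective ord ∧ IsVanishing k F ord

theorem rankIn_orderEmbOfFin {f k : ℕ} (e : Finset (Fin f)) (hc : e.card = k) (m : Fin k) :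
    rankIn (fun v : Fin f => (v : ℕ)) e (e.orderEmbOfFin hc m) = m := by
  have hfilter : e.filter (fun y : Fin f => (y : ℕ) < (e.orderEmbOfFin hc m : ℕ)) =
      (Finset.Iio m).map (e.orderEmbOfFin hc).toEmbedding := by
    ext y
    simp only [Finset.mem_filter, Finset.mem_map, Finset.mem_Iio, RelEmbedding.coe_toEmbedding]
    constructor
    · rintro ⟨hy, hlt⟩
      obtain ⟨i, rfl⟩ : y ∈ Set.range (e.orderEmbOfFin hc) := by
        rwa [Finset.range_orderEmbOfFin]
      exact ⟨i, (e.orderEmbOfFin hc).lt_iff_lt.1 hlt, rfl⟩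
    · rintro ⟨i, hi, rfl⟩
      exact ⟨e.orderEmbOfFin_mem hc i, (e.orderEmbOfFin hc).lt_iff_lt.2 hi⟩
  rw [rankIn, hfilter, Finset.card_map, Fin.card_Iio]

/-- The `n` cyclic successors of `ℓ` in `Fin (n + 1)` are the elements other than `ℓ - 1`. -/
theorem range_add_castLE {n : ℕ} (ℓ : Fin (n + 1)) :
    Set.range (fun j : Fin n => ℓ + Fin.castLE n.le_succ j) = {ℓ - 1}ᶜ := by
  have hlast : (Fin.last n) = -1 := by
    rw [eq_neg_iff_add_eq_zero, Fin.last_add_one]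
  ext i
  simp only [Set.mem_range, Set.mem_compl_iff, Set.mem_singleton_iff]
  constructor
  · rintro ⟨j, rfl⟩ h
    rw [sub_eq_add_neg, add_right_inj, ← hlast] at h
    exact (Fin.castSucc_lt_last j).ne h
  · intro h
    have hne : i - ℓ ≠ Fin.last n := by
      rw [hlast]
      intro h'
      exact h (by rw [sub_eq_add_neg, ← h']; abel)
    obtain ⟨j, hj⟩ := Fin.exists_castSucc_eq.2 hne
    exact ⟨j, by change ℓ + j.castSucc = i; rw [hj]; abel⟩

/-- Strictly increasing maps on `Fin (n + 1)` with the same image off `m` agree off `m`. -/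
theorem StrictMono.eqOn_compl_singleton_of_image_eq {α : Type*} [LinearOrder α] {n : ℕ}
    {g g' : Fin (n + 1) → α} (hg : StrictMono g) (hg' : StrictMono g') (m : Fin (n + 1))
    (h : g '' {m}ᶜ = g' '' {m}ᶜ) : Set.EqOn g g' {m}ᶜ := by
  have hcomp : g ∘ m.succAbove = g' ∘ m.succAbove := by
    rw [← StrictMono.range_inj (hg.comp m.strictMono_succAbove)
      (hg'.comp m.strictMono_succAbove), Set.range_comp, Set.range_comp, Fin.range_succAbove, h]
  intro i hi
  obtain ⟨j, rfl⟩ := Fin.exists_succAbove_eq hi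
  exact congrFun hcomp j

theorem orderEmbOfFin_image_compl_singleton {f k : ℕ} (e : Finset (Fin f)) (hc : e.card = k)
    (m : Fin k) :
    e.orderEmbOfFin hc '' {m}ᶜ = (e.erase (e.orderEmbOfFin hc m) : Finset (Fin f)) := by
  rw [Set.image_compl_eq_range_sdiff_image (e.orderEmbOfFin hc).injective,
    Finset.range_orderEmbOfFin, Set.image_singleton, Finset.coe_erase]

/-- In a vanishing `(n + 1)`-graph, cyclic listings of edges with one vertex left out are
determined by their vertex sets. -/
theorem IsVanishing.cyclic_listing_eq {n f : ℕ} {F : Finset (Finset (Fin f))}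
    (hvan : IsVanishing (n + 1) F (fun v => (v : ℕ))) {e e' : Finset (Fin f)}
    (he : e ∈ F) (he' : e' ∈ F) (hc : e.card = n + 1) (hc' : e'.card = n + 1)
    (ℓ ℓ' : Fin (n + 1))
    (h : Set.range (fun j : Fin n => e.orderEmbOfFin hc (ℓ + Fin.castLE n.le_succ j)) =
      Set.range (fun j : Fin n => e'.orderEmbOfFin hc' (ℓ' + Fin.castLE n.le_succ j))) :
    (fun j : Fin n => e.orderEmbOfFin hc (ℓ + Fin.castLE n.le_succ j)) =
      fun j : Fin n => e'.orderEmbOfFin hc' (ℓ' + Fin.castLE n.le_succ j) := by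
  obtain ⟨C, -, hC⟩ := hvan
  have himage : e.orderEmbOfFin hc '' {ℓ - 1}ᶜ = e'.orderEmbOfFin hc' '' {ℓ' - 1}ᶜ := by
    rwa [← range_add_castLE, ← range_add_castLE, ← Set.range_comp, ← Set.range_comp]
  have herase : e.erase (e.orderEmbOfFin hc (ℓ - 1)) =
      e'.erase (e'.orderEmbOfFin hc' (ℓ' - 1)) := by
    rwa [orderEmbOfFin_image_compl_singleton, orderEmbOfFin_image_compl_singleton,
      Finset.coe_inj] at himage
  have hrank := hC e he _ (e.orderEmbOfFin_mem hc (ℓ - 1))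
  rw [herase, hC e' he' _ (e'.orderEmbOfFin_mem hc' (ℓ' - 1)), rankIn_orderEmbOfFin,
    rankIn_orderEmbOfFin, Fin.val_inj, sub_left_inj] at hrank
  subst hrank
  funext j
  refine (e.orderEmbOfFin hc).strictMono.eqOn_compl_singleton_of_image_eq
    (e'.orderEmbOfFin hc').strictMono _ himage ?_
  rw [← range_add_castLE]
  exact Set.mem_range_self j

/-- Let `F` be a `k`-graph on `Fin f` for which the natural ordering
of `Fin f` is a vanishing ordering (the vertices listed in increasing order form
`τ = (v_1, …, v_f)`).  Define the `(k−1)`-uniform directed hypergraph `D` on `V(F)` by: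
for each edge `e = {v_{i(1)} < ⋯ < v_{i(k)}}` of `F` and each `ℓ ∈ Fin k`, the directed
edge `(v_{i(ℓ)}, v_{i(ℓ+1)}, …, v_{i(ℓ+k−2)})` (indices mod `k`, 0-based) is present with
color `ℓ`.  Then `D` is simple, every arc of the transitive digraph of the sub-digraph
`D_{0,1}` (directed edges colored `0` or `1`) goes from a vertex of smaller index to one
of larger index, and hence `T(D_{0,1})` is acyclic. -/
theorem stmt13 (k f : ℕ) [NeZero k] (hk : 2 ≤ k)
    (F : Finset (Finset (Fin f))) (hF : ∀ e ∈ F, e.card = k)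
    (hvan : IsVanishing k F (fun v => (v : ℕ)))
    (D : (Fin (k - 1) → Fin f) → Option (Fin k))
    (hD : ∀ (t : Fin (k - 1) → Fin f) (c : Fin k),
      D t = some c ↔ ∃ e ∈ F, ∃ hc : e.card = k, ∃ ℓ : Fin k, c = ℓ ∧
        t = fun j : Fin (k - 1) => e.orderEmbOfFin hc (ℓ + Fin.castLE (Nat.sub_le k 1) j)) :
    (∀ t t', D t ≠ none → D t' ≠ none → Set.range t = Set.range t' → t = t') ∧
    (∀ x y : Fin f,
      (∃ t, (D t = some 0 ∨ D t = some 1) ∧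
        ∃ a b : Fin (k - 1), a < b ∧ t a = x ∧ t b = y) → (x : ℕ) < (y : ℕ)) ∧
    (∀ x : Fin f, ¬ Relation.TransGen
      (fun x y => ∃ t, (D t = some 0 ∨ D t = some 1) ∧
        ∃ a b : Fin (k - 1), a < b ∧ t a = x ∧ t b = y) x x) := by
  have arc_lt : ∀ x y : Fin f,
      (∃ t, (D t = some 0 ∨ D t = some 1) ∧
        ∃ a b : Fin (k - 1), a < b ∧ t a = x ∧ t b = y) → (x : ℕ) < (y : ℕ) := by
    rintro x y ⟨t, ht, a, b, hab, rfl, rfl⟩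
    obtain ⟨ℓ, hℓ, htℓ⟩ : ∃ ℓ : Fin k, (ℓ : ℕ) ≤ 1 ∧ D t = some ℓ := by
      rcases ht with ht | ht
      · exact ⟨0, by simp, ht⟩
      · exact ⟨1, by rw [Fin.val_one']; exact Nat.mod_le 1 k, ht⟩
    obtain ⟨e, -, hc, _, rfl, rfl⟩ := (hD t ℓ).1 htℓ
    refine (e.orderEmbOfFin hc).lt_iff_lt.2 ?_
    rw [Fin.lt_def, Fin.val_add, Fin.val_add, Fin.val_castLE, Fin.val_castLE,
      Nat.mod_eq_of_lt (by omega), Nat.mod_eq_of_lt (by omega)]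
    exact Nat.add_lt_add_left hab _
  refine ⟨?_, arc_lt, ?_⟩
  · intro t t' ht ht' hrange
    obtain ⟨c, hc⟩ := Option.ne_none_iff_exists'.1 ht
    obtain ⟨c', hc'⟩ := Option.ne_none_iff_exists'.1 ht'
    obtain ⟨e, he, hcard, ℓ, -, rfl⟩ := (hD t c).1 hc
    obtain ⟨e', he', hcard', ℓ', -, rfl⟩ := (hD t' c').1 hc'
    obtain ⟨n, rfl⟩ : ∃ n, k = n + 1 := ⟨k - 1, by omega⟩
    exact hvan.cyclic_listing_eq he he' hcard hcard' ℓ ℓ' hrange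
  · intro x hx
    exact lt_irrefl x (Relation.transGen_minimal (r' := fun x y : Fin f => x < y) arc_lt x x hx)

end
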